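/- Assume the AG₂ setup and the definition of the rational functions a_τ (for τ/2 ∈ G₂) below, and let κ_τ = 3 for τ ∈ {±2β₁, ±2β₂, ±2β₃}, κ_τ = 1 for τ ∈ {±2α₁, ±2α₂, ±2α₃}, and n(γ) = m_γ + m_{2γ} for γ ∈ G₂₊ (so n(αᵢ) = m, n(βᵢ) = 3m+1). Then for each τ with τ/2 ∈ G₂ there exist polynomials u, v ∈ ℂ[z₁,z₂] with v ≠ 0 and total degree of u at most (total degree of v) − 2, such that for every D₁-regular z with v(z) ≠ 0: a_τ(z) = κ_τ − κ_τ · ∑_{γ∈G₂₊} ⟨τ,γ⟩·n(γ)/⟨γ,z⟩ + u(z)/v(z). -/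

import Mathlib

noncomputable section

open Complex

/-- The bilinear extension of the Euclidean inner product on `ℂ²`. -/
def bil (z w : Fin 2 → ℂ) : ℂ := z 0 * w 0 + z 1 * w 1

/-- `√3` as a complex number. -/
def rt3 : ℂ := (Real.sqrt 3 : ℝ)

def vα₁ : Fin 2 → ℂ := ![0, rt3]
def vα₂ : Fin 2 → ℂ := ![-(3/2), rt3 / 2]
def vα₃ : Fin 2 → ℂ := ![3/2, rt3 / 2]
def vβ₁ : Fin 2 → ℂ := ![1, 0]
def vβ₂ : Fin 2 → ℂ := ![1/2, rt3 / 2]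
def vβ₃ : Fin 2 → ℂ := ![-(1/2), rt3 / 2]

/-- Positive roots of `G₂`: `α₁, α₂, α₃, β₁, β₂, β₃`. -/
def G2plus : List (Fin 2 → ℂ) := [vα₁, vα₂, vα₃, vβ₁, vβ₂, vβ₃]
/-- The six short roots `±βᵢ` of `G₂`. -/
def shortRoots : List (Fin 2 → ℂ) := [vβ₁, vβ₂, vβ₃, -vβ₁, -vβ₂, -vβ₃]
/-- The six long roots `±αᵢ` of `G₂`. -/
def longRoots : List (Fin 2 → ℂ) := [vα₁, vα₂, vα₃, -vα₁, -vα₂, -vα₃]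
/-- All twelve roots of `G₂`. -/
def G2all : List (Fin 2 → ℂ) := longRoots ++ shortRoots
/-- The twelve vectors `2γ`, `γ ∈ G₂`. -/
def twoG2 : List (Fin 2 → ℂ) := G2all.map (fun γ => (2 : ℂ) • γ)
/-- The six vectors `±2βⱼ`. -/
def twoShort : List (Fin 2 → ℂ) := shortRoots.map (fun γ => (2 : ℂ) • γ)
/-- The six vectors `±2αⱼ`. -/
def twoLong : List (Fin 2 → ℂ) := longRoots.map (fun γ => (2 : ℂ) • γ)
/-- The six vectors `±4βⱼ`. -/
def fourShort : List (Fin 2 → ℂ) := shortRoots.map (fun γ => (4 : ℂ) • γ)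
/-- The eighteen vectors `2γ`, `γ ∈ AG₂`. -/
def twoAG2 : List (Fin 2 → ℂ) := twoG2 ++ fourShort

/-- The quasi-invariance conditions for the configuration `AG₂` with
multiplicities `m_{αᵢ} = m`, `m_{βᵢ} = 3m`, `m_{2βᵢ} = 1`. -/
def QuasiInvAG2 (m : ℕ) (ψ : (Fin 2 → ℂ) → ℂ) : Prop :=
  (∀ α ∈ [vα₁, vα₂, vα₃], ∀ s : ℕ, 1 ≤ s → s ≤ m →
    ∀ z : Fin 2 → ℂ, bil α z = 0 →
      ψ (z + (s : ℂ) • α) = ψ (z - (s : ℂ) • α)) ∧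
  (∀ β ∈ [vβ₁, vβ₂, vβ₃], ∀ s : ℕ, ((1 ≤ s ∧ s ≤ 3 * m) ∨ s = 3 * m + 2) →
    ∀ z : Fin 2 → ℂ, bil β z = 0 →
      ψ (z + (s : ℂ) • β) = ψ (z - (s : ℂ) • β))

/-- The linear form `z ↦ ⟨γ, z⟩` as a polynomial in `z₁, z₂`. -/
def linForm (γ : Fin 2 → ℂ) : MvPolynomial (Fin 2) ℂ :=
  MvPolynomial.C (γ 0) * MvPolynomial.X 0 + MvPolynomial.C (γ 1) * MvPolynomial.X 1

/-- The highest-order term `∏ᵢ ⟨αᵢ,z⟩^m ⟨βᵢ,z⟩^{3m} ⟨2βᵢ,z⟩` of the polynomial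
part of the Baker–Akhiezer function for `AG₂`. -/
def topTerm (m : ℕ) : MvPolynomial (Fin 2) ℂ :=
  (linForm vα₁ * linForm vα₂ * linForm vα₃) ^ m *
    (linForm vβ₁ * linForm vβ₂ * linForm vβ₃) ^ (3 * m) *
    (linForm ((2 : ℂ) • vβ₁) * linForm ((2 : ℂ) • vβ₂) * linForm ((2 : ℂ) • vβ₃))

/-- A Baker–Akhiezer function for `AG₂` at `x`. -/
def IsBAFunction (m : ℕ) (x : Fin 2 → ℂ) (ψ : (Fin 2 → ℂ) → ℂ) : Prop :=
  ∃ P : MvPolynomial (Fin 2) ℂ,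
    P.totalDegree = 12 * m + 3 ∧
    MvPolynomial.homogeneousComponent (12 * m + 3) P = topTerm m ∧
    (∀ z, ψ z = MvPolynomial.eval z P * Complex.exp (bil z x)) ∧
    QuasiInvAG2 m ψ

/-- `z` is `D₁`-regular: `⟨γ,z⟩ ∉ {0, ±γ², ±2γ²}` for every `γ ∈ G₂₊`. -/
def D1Reg (z : Fin 2 → ℂ) : Prop :=
  ∀ γ ∈ G2plus, bil γ z ≠ 0 ∧ bil γ z ≠ bil γ γ ∧ bil γ z ≠ -bil γ γ ∧
    bil γ z ≠ 2 * bil γ γ ∧ bil γ z ≠ -(2 * bil γ γ)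

open scoped Classical in
/-- The coefficient functions `a_τ` (for `τ/2 ∈ G₂`) of the dual
Macdonald–Ruijsenaars operator `D₁` for `AG₂`. -/
noncomputable def aD1 (m : ℕ) (τ z : Fin 2 → ℂ) : ℂ :=
  let h : Fin 2 → ℂ := (2⁻¹ : ℂ) • τ
  if τ ∈ twoShort then
    3 *
      ((shortRoots.filter (fun γ => bil τ γ = bil γ γ)).map (fun γ =>
        (1 - (3 * (m : ℂ) + 2) * bil γ γ / bil γ z) *
        (1 + 3 * (m : ℂ) * bil γ γ / (bil γ z + 2 * bil γ γ)) *
        (1 - (3 * (m : ℂ) - 1) * bil γ γ / (bil γ z - bil γ γ)))).prod *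
      ((longRoots.filter (fun γ => bil τ γ = bil γ γ)).map (fun γ =>
        1 - (m : ℂ) * bil γ γ / bil γ z)).prod *
      ((1 - (3 * (m : ℂ) + 2) * bil h h / bil h z) *
        (1 - 3 * (m : ℂ) * bil h h / (bil h z + bil h h)))
  else
    ((shortRoots.filter (fun γ => bil τ γ = 3 * bil γ γ)).map (fun γ =>
        (1 - (3 * (m : ℂ) + 2) * bil γ γ / bil γ z) *
        (1 - (3 * (m : ℂ) + 1) * bil γ γ / (bil γ z + bil γ γ)) *
        (1 - 3 * (m : ℂ) * bil γ γ / (bil γ z + 2 * bil γ γ)))).prod *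
      ((longRoots.filter (fun γ => bil τ γ = bil γ γ)).map (fun γ =>
        1 - (m : ℂ) * bil γ γ / bil γ z)).prod *
      ((1 - (m : ℂ) * bil h h / bil h z) *
        (1 - (m : ℂ) * bil h h / (bil h z + bil h h)))

/-- The value `D₁p(z) = ∑_{τ : τ/2 ∈ G₂} a_τ(z)(p(z+τ) − p(z))`. -/
noncomputable def applyD1 (m : ℕ) (p : (Fin 2 → ℂ) → ℂ) (z : Fin 2 → ℂ) : ℂ :=
  (twoG2.map (fun τ => aD1 m τ z * (p (z + τ) - p z))).sum

/-- The ring `R^a_{AG₂}` of analytic quasi-invariants for `AG₂`. -/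
def RaAG2 (m : ℕ) (p : (Fin 2 → ℂ) → ℂ) : Prop :=
  (∀ z, AnalyticAt ℂ p z) ∧ QuasiInvAG2 m p

open scoped Classical in
/-- The constant `κ_τ`: `3` for `τ = ±2βⱼ` and `1` for `τ = ±2αⱼ`. -/
noncomputable def kap (τ : Fin 2 → ℂ) : ℂ := if τ ∈ twoShort then 3 else 1

open scoped Classical in
/-- `n(γ) = m_γ + m_{2γ}` for `γ ∈ G₂₊`: equals `3m+1` for short roots `βᵢ`
and `m` for long roots `αᵢ`. -/
noncomputable def multSum (m : ℕ) (γ : Fin 2 → ℂ) : ℕ :=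
  if γ ∈ [vβ₁, vβ₂, vβ₃] then 3 * m + 1 else m

lemma rt3_sq : rt3 * rt3 = 3 := by
  unfold rt3
  rw [← Complex.ofReal_mul, Real.mul_self_sqrt (by norm_num)]
  norm_num

/-- `f` is a rational function of degree at most `-k`. -/
def Asym (k : ℕ) (f : (Fin 2 → ℂ) → ℂ) : Prop :=
  ∃ u v : MvPolynomial (Fin 2) ℂ, v ≠ 0 ∧ u.totalDegree + k ≤ v.totalDegree ∧
    ∀ z, MvPolynomial.eval z v ≠ 0 → f z = MvPolynomial.eval z u / MvPolynomial.eval z v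

lemma Asym.congr {k : ℕ} {f g : (Fin 2 → ℂ) → ℂ} (h : Asym k f) (hfg : ∀ z, g z = f z) :
    Asym k g := by
  rwa [show g = f from funext hfg]

lemma Asym.mono {j k : ℕ} {f : (Fin 2 → ℂ) → ℂ} (h : Asym k f) (hjk : j ≤ k) :
    Asym j f := by
  obtain ⟨u, v, h1, h2, h3⟩ := h
  exact ⟨u, v, h1, by omega, h3⟩

lemma Asym.mul {j k : ℕ} {f g : (Fin 2 → ℂ) → ℂ} (hf : Asym j f) (hg : Asym k g) :
    Asym (j + k) (fun z => f z * g z) := by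
  obtain ⟨u, v, h1, h2, h3⟩ := hf
  obtain ⟨u', v', h1', h2', h3'⟩ := hg
  refine ⟨u * u', v * v', mul_ne_zero h1 h1', ?_, ?_⟩
  · rw [MvPolynomial.totalDegree_mul_of_isDomain h1 h1']
    have := MvPolynomial.totalDegree_mul u u'
    omega
  · intro z hz
    rw [map_mul] at hz
    simp only [map_mul]
    rw [h3 z (left_ne_zero_of_mul hz), h3' z (right_ne_zero_of_mul hz), div_mul_div_comm]

lemma Asym.add {k : ℕ} {f g : (Fin 2 → ℂ) → ℂ} (hf : Asym k f) (hg : Asym k g) :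
    Asym k (fun z => f z + g z) := by
  obtain ⟨u, v, h1, h2, h3⟩ := hf
  obtain ⟨u', v', h1', h2', h3'⟩ := hg
  refine ⟨u * v' + v * u', v * v', mul_ne_zero h1 h1', ?_, ?_⟩
  · rw [MvPolynomial.totalDegree_mul_of_isDomain h1 h1']
    have a1 := MvPolynomial.totalDegree_mul u v'
    have a2 := MvPolynomial.totalDegree_mul v u'
    have a3 := MvPolynomial.totalDegree_add (u * v') (v * u')
    rcases le_max_iff.1 a3 with h | h <;> omega
  · intro z hz
    rw [map_mul] at hz
    simp only [map_mul, map_add]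
    have e1 := left_ne_zero_of_mul hz
    have e2 := right_ne_zero_of_mul hz
    rw [h3 z e1, h3' z e2, div_add_div _ _ e1 e2]

lemma Asym.zero (f : (Fin 2 → ℂ) → ℂ) (k : ℕ) (hf : ∀ z, f z = 0) : Asym k f := by
  refine ⟨0, MvPolynomial.X 0 ^ k, pow_ne_zero _ (MvPolynomial.X_ne_zero 0), ?_, ?_⟩
  · simp [MvPolynomial.totalDegree_X_pow]
  · intro z _; simp [hf]

lemma Asym.const (c : ℂ) : Asym 0 (fun _ => c) :=
  ⟨MvPolynomial.C c, 1, one_ne_zero, by simp, by intro z _; simp⟩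

lemma eval_linForm_add (γ z : Fin 2 → ℂ) (s : ℂ) :
    MvPolynomial.eval z (linForm γ + MvPolynomial.C s) = bil γ z + s := by
  simp [linForm, bil]

lemma linForm_deg (γ : Fin 2 → ℂ) (hγ : γ ≠ 0) (s : ℂ) :
    1 ≤ (linForm γ + MvPolynomial.C s).totalDegree := by
  by_contra hlt
  have h0 : (linForm γ + MvPolynomial.C s).totalDegree = 0 := by omega
  rw [MvPolynomial.totalDegree_eq_zero_iff_eq_C] at h0
  have key : ∀ z, bil γ z + s = bil γ 0 + s := by
    intro z
    rw [← eval_linForm_add, ← eval_linForm_add, h0]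
    simp
  apply hγ
  have k0 := key ![1, 0]
  have k1 := key ![0, 1]
  simp [bil] at k0 k1
  ext i
  fin_cases i <;> simp [k0, k1]

lemma Asym.inv (γ : Fin 2 → ℂ) (hγ : γ ≠ 0) (c s : ℂ) :
    Asym 1 (fun z => c / (bil γ z + s)) := by
  have hd := linForm_deg γ hγ s
  refine ⟨MvPolynomial.C c, linForm γ + MvPolynomial.C s, ?_, ?_, ?_⟩
  · intro h; rw [h] at hd; simp at hd
  · simpa using hd
  · intro z _
    rw [eval_linForm_add]; simp

lemma Asym.diff (γ : Fin 2 → ℂ) (hγ : γ ≠ 0) (c s : ℂ) :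
    Asym 2 (fun z => c / bil γ z - c / (bil γ z + s)) := by
  have hd := linForm_deg γ hγ s
  have hd0 := linForm_deg γ hγ 0
  have n1 : linForm γ + MvPolynomial.C s ≠ 0 := by
    intro h; rw [h] at hd; simp at hd
  have n0 : linForm γ + MvPolynomial.C 0 ≠ 0 := by
    intro h; rw [h] at hd0; simp at hd0
  refine ⟨MvPolynomial.C (c * s), (linForm γ + MvPolynomial.C 0) * (linForm γ + MvPolynomial.C s),
    mul_ne_zero n0 n1, ?_, ?_⟩
  · rw [MvPolynomial.totalDegree_mul_of_isDomain n0 n1]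
    simp only [MvPolynomial.totalDegree_C]
    omega
  · intro z hz
    rw [map_mul, eval_linForm_add, eval_linForm_add, add_zero] at hz
    rw [MvPolynomial.eval_C, map_mul, eval_linForm_add, eval_linForm_add, add_zero]
    beta_reduce
    have e1 := left_ne_zero_of_mul hz
    have e2 := right_ne_zero_of_mul hz
    field_simp
    ring

/-- `f = 1 + L + (terms of degree at most -2)`, with `L` of degree at most `-1`. -/
def Expn (f L : (Fin 2 → ℂ) → ℂ) : Prop :=
  Asym 1 L ∧ Asym 2 (fun z => f z - 1 - L z)

lemma Expn.congr {f L f' L' : (Fin 2 → ℂ) → ℂ} (h : Expn f L) (hf : ∀ z, f' z = f z)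
    (hL : ∀ z, L' z = L z) : Expn f' L' := by
  rwa [show f' = f from funext hf, show L' = L from funext hL]

lemma Expn.one : Expn (fun _ => 1) (fun _ => 0) :=
  ⟨Asym.zero _ _ (by simp), Asym.zero _ _ (by simp)⟩

lemma Expn.mul {f L f' L' : (Fin 2 → ℂ) → ℂ} (h : Expn f L) (h' : Expn f' L') :
    Expn (fun z => f z * f' z) (fun z => L z + L' z) := by
  obtain ⟨hL, hR⟩ := h
  obtain ⟨hL', hR'⟩ := h'
  refine ⟨hL.add hL', ?_⟩
  have b : Asym 0 (fun z => 1 + L z) := (Asym.const 1).add (hL.mono (by omega))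
  have b' : Asym 0 (fun z => 1 + L' z) := (Asym.const 1).add (hL'.mono (by omega))
  have t1 : Asym 2 (fun z => L z * L' z) := hL.mul hL'
  have t2 : Asym 2 (fun z => (1 + L z) * (f' z - 1 - L' z)) := (b.mul hR').mono (by omega)
  have t3 : Asym 2 (fun z => (f z - 1 - L z) * (1 + L' z)) := (hR.mul b').mono (by omega)
  have t4 : Asym 2 (fun z => (f z - 1 - L z) * (f' z - 1 - L' z)) :=
    (hR.mul hR').mono (by omega)
  exact (((t1.add t2).add t3).add t4).congr (fun z => by ring)

lemma Expn.basic (γ : Fin 2 → ℂ) (hγ : γ ≠ 0) (c s : ℂ) :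
    Expn (fun z => 1 - c / (bil γ z + s)) (fun z => -c / bil γ z) :=
  ⟨(Asym.inv γ hγ (-c) 0).congr (fun z => by simp),
    (Asym.diff γ hγ c s).congr (fun z => by ring)⟩

lemma Expn.basic0 (γ : Fin 2 → ℂ) (hγ : γ ≠ 0) (c : ℂ) :
    Expn (fun z => 1 - c / bil γ z) (fun z => -c / bil γ z) :=
  (Expn.basic γ hγ c 0).congr (fun z => by simp) (fun z => rfl)

lemma Expn.list (l : List (Fin 2 → ℂ)) (F G : (Fin 2 → ℂ) → (Fin 2 → ℂ) → ℂ)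
    (h : ∀ γ ∈ l, Expn (F γ) (G γ)) :
    Expn (fun z => (l.map (fun γ => F γ z)).prod) (fun z => (l.map (fun γ => G γ z)).sum) := by
  induction l with
  | nil => simpa using Expn.one
  | cons a l ih =>
    simp only [List.map_cons, List.prod_cons, List.sum_cons]
    exact (h a (by simp)).mul (ih (fun γ hγ => h γ (by simp [hγ])))

lemma expn_short (m : ℂ) (ls ll : List (Fin 2 → ℂ)) (h : Fin 2 → ℂ)
    (hs : ∀ γ ∈ ls, γ ≠ 0) (hl : ∀ γ ∈ ll, γ ≠ 0) (hh : h ≠ 0) :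
    Expn (fun z => (ls.map (fun γ =>
        (1 - (3 * m + 2) * bil γ γ / bil γ z) *
        (1 + 3 * m * bil γ γ / (bil γ z + 2 * bil γ γ)) *
        (1 - (3 * m - 1) * bil γ γ / (bil γ z - bil γ γ)))).prod *
      (ll.map (fun γ => 1 - m * bil γ γ / bil γ z)).prod *
      ((1 - (3 * m + 2) * bil h h / bil h z) *
        (1 - 3 * m * bil h h / (bil h z + bil h h))))
      (fun z => (ls.map (fun γ => -((3 * m + 1) * bil γ γ / bil γ z))).sum +
        (ll.map (fun γ => -(m * bil γ γ / bil γ z))).sum -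
        (6 * m + 2) * bil h h / bil h z) := by
  have A := Expn.list ls (fun γ z => (1 - (3 * m + 2) * bil γ γ / bil γ z) *
        (1 + 3 * m * bil γ γ / (bil γ z + 2 * bil γ γ)) *
        (1 - (3 * m - 1) * bil γ γ / (bil γ z - bil γ γ)))
      (fun γ z => -((3 * m + 1) * bil γ γ / bil γ z)) (fun γ hγ =>
      (((Expn.basic0 γ (hs γ hγ) ((3 * m + 2) * bil γ γ)).mul
        (Expn.basic γ (hs γ hγ) (-(3 * m * bil γ γ)) (2 * bil γ γ))).mul
        (Expn.basic γ (hs γ hγ) ((3 * m - 1) * bil γ γ) (-bil γ γ))).congr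
        (fun z => by rw [neg_div, sub_neg_eq_add, ← sub_eq_add_neg]) (fun z => by ring))
  have B := Expn.list ll (fun γ z => 1 - m * bil γ γ / bil γ z)
      (fun γ z => -(m * bil γ γ / bil γ z)) (fun γ hγ =>
      (Expn.basic0 γ (hl γ hγ) (m * bil γ γ)).congr (fun z => rfl) (fun z => by ring))
  have C := (Expn.basic0 h hh ((3 * m + 2) * bil h h)).mul
    (Expn.basic h hh (3 * m * bil h h) (bil h h))
  exact ((A.mul B).mul C).congr (fun z => rfl) (fun z => by ring)

lemma expn_long (m : ℂ) (ls ll : List (Fin 2 → ℂ)) (h : Fin 2 → ℂ)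
    (hs : ∀ γ ∈ ls, γ ≠ 0) (hl : ∀ γ ∈ ll, γ ≠ 0) (hh : h ≠ 0) :
    Expn (fun z => (ls.map (fun γ =>
        (1 - (3 * m + 2) * bil γ γ / bil γ z) *
        (1 - (3 * m + 1) * bil γ γ / (bil γ z + bil γ γ)) *
        (1 - 3 * m * bil γ γ / (bil γ z + 2 * bil γ γ)))).prod *
      (ll.map (fun γ => 1 - m * bil γ γ / bil γ z)).prod *
      ((1 - m * bil h h / bil h z) *
        (1 - m * bil h h / (bil h z + bil h h))))
      (fun z => (ls.map (fun γ => -((9 * m + 3) * bil γ γ / bil γ z))).sum +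
        (ll.map (fun γ => -(m * bil γ γ / bil γ z))).sum -
        2 * m * bil h h / bil h z) := by
  have A := Expn.list ls (fun γ z => (1 - (3 * m + 2) * bil γ γ / bil γ z) *
        (1 - (3 * m + 1) * bil γ γ / (bil γ z + bil γ γ)) *
        (1 - 3 * m * bil γ γ / (bil γ z + 2 * bil γ γ)))
      (fun γ z => -((9 * m + 3) * bil γ γ / bil γ z)) (fun γ hγ =>
      (((Expn.basic0 γ (hs γ hγ) ((3 * m + 2) * bil γ γ)).mul
        (Expn.basic γ (hs γ hγ) ((3 * m + 1) * bil γ γ) (bil γ γ))).mul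
        (Expn.basic γ (hs γ hγ) (3 * m * bil γ γ) (2 * bil γ γ))).congr
        (fun z => rfl) (fun z => by ring))
  have B := Expn.list ll (fun γ z => 1 - m * bil γ γ / bil γ z)
      (fun γ z => -(m * bil γ γ / bil γ z)) (fun γ hγ =>
      (Expn.basic0 γ (hl γ hγ) (m * bil γ γ)).congr (fun z => rfl) (fun z => by ring))
  have C := (Expn.basic0 h hh (m * bil h h)).mul
    (Expn.basic h hh (m * bil h h) (bil h h))
  exact ((A.mul B).mul C).congr (fun z => rfl) (fun z => by ring)

lemma bil_neg_left (x y : Fin 2 → ℂ) : bil (-x) y = -bil x y := by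
  simp [bil]; ring
lemma bil_neg_right (x y : Fin 2 → ℂ) : bil x (-y) = -bil x y := by
  simp [bil]; ring
lemma bil_smul_left (c : ℂ) (x y : Fin 2 → ℂ) : bil (c • x) y = c * bil x y := by
  simp [bil]; ring

lemma bil_comm' (x y : Fin 2 → ℂ) : bil x y = bil y x := by
  simp [bil]; ring

lemma bαα : bil vα₁ vα₁ = 3 ∧ bil vα₂ vα₂ = 3 ∧ bil vα₃ vα₃ = 3 ∧ bil vα₁ vα₂ = 3/2 ∧
    bil vα₁ vα₃ = 3/2 ∧ bil vα₂ vα₃ = -(3/2) ∧ bil vα₂ vα₁ = 3/2 ∧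
    bil vα₃ vα₁ = 3/2 ∧ bil vα₃ vα₂ = -(3/2) := by
  have h := rt3_sq
  simp only [bil, vα₁, vα₂, vα₃, Matrix.cons_val_zero, Matrix.cons_val_one]
  refine ⟨?_, ?_, ?_, ?_, ?_, ?_, ?_, ?_, ?_⟩ <;> grind

lemma bββ : bil vβ₁ vβ₁ = 1 ∧ bil vβ₂ vβ₂ = 1 ∧ bil vβ₃ vβ₃ = 1 ∧ bil vβ₁ vβ₂ = 1/2 ∧
    bil vβ₁ vβ₃ = -(1/2) ∧ bil vβ₂ vβ₃ = 1/2 ∧ bil vβ₂ vβ₁ = 1/2 ∧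
    bil vβ₃ vβ₁ = -(1/2) ∧ bil vβ₃ vβ₂ = 1/2 := by
  have h := rt3_sq
  simp only [bil, vβ₁, vβ₂, vβ₃, Matrix.cons_val_zero, Matrix.cons_val_one]
  refine ⟨?_, ?_, ?_, ?_, ?_, ?_, ?_, ?_, ?_⟩ <;> grind

lemma bαβ : bil vα₁ vβ₁ = 0 ∧ bil vα₁ vβ₂ = 3/2 ∧ bil vα₁ vβ₃ = 3/2 ∧
    bil vα₂ vβ₁ = -(3/2) ∧ bil vα₂ vβ₂ = 0 ∧ bil vα₂ vβ₃ = 3/2 ∧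
    bil vα₃ vβ₁ = 3/2 ∧ bil vα₃ vβ₂ = 3/2 ∧ bil vα₃ vβ₃ = 0 := by
  have h := rt3_sq
  simp only [bil, vα₁, vα₂, vα₃, vβ₁, vβ₂, vβ₃, Matrix.cons_val_zero, Matrix.cons_val_one]
  refine ⟨?_, ?_, ?_, ?_, ?_, ?_, ?_, ?_, ?_⟩ <;> grind

lemma bβα : bil vβ₁ vα₁ = 0 ∧ bil vβ₂ vα₁ = 3/2 ∧ bil vβ₃ vα₁ = 3/2 ∧
    bil vβ₁ vα₂ = -(3/2) ∧ bil vβ₂ vα₂ = 0 ∧ bil vβ₃ vα₂ = 3/2 ∧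
    bil vβ₁ vα₃ = 3/2 ∧ bil vβ₂ vα₃ = 3/2 ∧ bil vβ₃ vα₃ = 0 := by
  simpa only [bil_comm' vβ₁, bil_comm' vβ₂, bil_comm' vβ₃] using bαβ

lemma short_norm {γ : Fin 2 → ℂ} (h : γ ∈ shortRoots) : bil γ γ = 1 := by
  simp only [shortRoots, List.mem_cons, List.not_mem_nil, or_false] at h
  rcases h with rfl | rfl | rfl | rfl | rfl | rfl <;>
    simp [bil_neg_left, bil_neg_right, bββ]

lemma long_norm {γ : Fin 2 → ℂ} (h : γ ∈ longRoots) : bil γ γ = 3 := by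
  simp only [longRoots, List.mem_cons, List.not_mem_nil, or_false] at h
  rcases h with rfl | rfl | rfl | rfl | rfl | rfl <;>
    simp [bil_neg_left, bil_neg_right, bαα]

lemma short_ne {γ : Fin 2 → ℂ} (h : γ ∈ shortRoots) : γ ≠ 0 := by
  rintro rfl
  have := short_norm h
  simp [bil] at this

lemma long_ne {γ : Fin 2 → ℂ} (h : γ ∈ longRoots) : γ ≠ 0 := by
  rintro rfl
  have := long_norm h
  simp [bil] at this

lemma long_not_twoShort {γ : Fin 2 → ℂ} (h : γ ∈ longRoots) : (2 : ℂ) • γ ∉ twoShort := by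
  intro h'
  obtain ⟨δ, hδ, e⟩ := List.mem_map.1 h'
  have e' : δ = γ := smul_right_injective _ (two_ne_zero' ℂ) e
  have := long_norm h
  rw [← e', short_norm hδ] at this
  norm_num at this

lemma short_twoShort {γ : Fin 2 → ℂ} (h : γ ∈ shortRoots) : (2 : ℂ) • γ ∈ twoShort :=
  List.mem_map.2 ⟨γ, h, rfl⟩

lemma multSum_beta (m : ℕ) : multSum m vβ₁ = 3 * m + 1 ∧ multSum m vβ₂ = 3 * m + 1 ∧
    multSum m vβ₃ = 3 * m + 1 := by
  simp [multSum]

lemma multSum_long (m : ℕ) {γ : Fin 2 → ℂ} (h : γ ∈ longRoots) : multSum m γ = m := by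
  unfold multSum
  rw [if_neg]
  intro h'
  have h2 : γ ∈ shortRoots := by
    simp only [shortRoots, List.mem_cons, List.not_mem_nil, or_false] at h' ⊢
    tauto
  have := long_norm h
  rw [short_norm h2] at this
  norm_num at this

lemma multSum_alpha (m : ℕ) : multSum m vα₁ = m ∧ multSum m vα₂ = m ∧ multSum m vα₃ = m :=
  ⟨multSum_long m (by simp [longRoots]), multSum_long m (by simp [longRoots]),
    multSum_long m (by simp [longRoots])⟩

lemma Expn.finish {f L a S : (Fin 2 → ℂ) → ℂ} (κ : ℂ) (h : Expn f L)
    (ha : ∀ z, a z = κ * f z) (hL : ∀ z, L z = -S z) :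
    ∃ u v : MvPolynomial (Fin 2) ℂ, v ≠ 0 ∧
      u.totalDegree + 2 ≤ v.totalDegree ∧
      ∀ z : Fin 2 → ℂ, D1Reg z → MvPolynomial.eval z v ≠ 0 →
        a z = κ - κ * S z + MvPolynomial.eval z u / MvPolynomial.eval z v := by
  obtain ⟨u, v, h1, h2, h3⟩ := ((Asym.const κ).mul h.2).mono (show 2 ≤ 0 + 2 by omega)
  refine ⟨u, v, h1, h2, fun z _ hz => ?_⟩
  rw [← h3 z hz, ha]
  beta_reduce
  rw [hL]
  ring

open scoped Classical in
lemma short_sum (m : ℕ) {h : Fin 2 → ℂ} (hh : h ∈ shortRoots) (z : Fin 2 → ℂ) :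
    ((shortRoots.filter (fun γ => bil ((2 : ℂ) • h) γ = bil γ γ)).map
      (fun γ => -((3 * (m : ℂ) + 1) * bil γ γ / bil γ z))).sum +
    ((longRoots.filter (fun γ => bil ((2 : ℂ) • h) γ = bil γ γ)).map
      (fun γ => -((m : ℂ) * bil γ γ / bil γ z))).sum -
    (6 * (m : ℂ) + 2) * bil h h / bil h z =
    -(G2plus.map (fun γ => bil ((2 : ℂ) • h) γ * (multSum m γ : ℂ) / bil γ z)).sum := by
  simp only [shortRoots, List.mem_cons, List.not_mem_nil, or_false] at hh
  rcases hh with rfl | rfl | rfl | rfl | rfl | rfl <;>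
    norm_num [shortRoots, longRoots, G2plus, List.filter_cons, bil_smul_left, bil_neg_left,
      bil_neg_right, bαα, bββ, bαβ, bβα, multSum_alpha, multSum_beta, div_neg] <;> ring

open scoped Classical in
lemma long_sum (m : ℕ) {h : Fin 2 → ℂ} (hh : h ∈ longRoots) (z : Fin 2 → ℂ) :
    ((shortRoots.filter (fun γ => bil ((2 : ℂ) • h) γ = 3 * bil γ γ)).map
      (fun γ => -((9 * (m : ℂ) + 3) * bil γ γ / bil γ z))).sum +
    ((longRoots.filter (fun γ => bil ((2 : ℂ) • h) γ = bil γ γ)).map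
      (fun γ => -((m : ℂ) * bil γ γ / bil γ z))).sum -
    2 * (m : ℂ) * bil h h / bil h z =
    -(G2plus.map (fun γ => bil ((2 : ℂ) • h) γ * (multSum m γ : ℂ) / bil γ z)).sum := by
  simp only [longRoots, List.mem_cons, List.not_mem_nil, or_false] at hh
  rcases hh with rfl | rfl | rfl | rfl | rfl | rfl <;>
    norm_num [shortRoots, longRoots, G2plus, List.filter_cons, bil_smul_left, bil_neg_left,
      bil_neg_right, bαα, bββ, bαβ, bβα, multSum_alpha, multSum_beta, div_neg] <;> ring

/-- Expansion of the coefficients `a_τ` of `D₁`: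
`a_τ(z) = κ_τ − κ_τ ∑_{γ∈G₂₊} ⟨τ,γ⟩(m_γ+m_{2γ})/⟨γ,z⟩ + (terms of degree ≤ −2)`. -/
theorem stmt_10 (m : ℕ) (hm : 1 ≤ m) (τ : Fin 2 → ℂ) (hτ : τ ∈ twoG2) :
    ∃ u v : MvPolynomial (Fin 2) ℂ, v ≠ 0 ∧
      u.totalDegree + 2 ≤ v.totalDegree ∧
      ∀ z : Fin 2 → ℂ, D1Reg z → MvPolynomial.eval z v ≠ 0 →
        aD1 m τ z =
          kap τ
            - kap τ *
              (G2plus.map (fun γ => bil τ γ * (multSum m γ : ℂ) / bil γ z)).sum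
            + MvPolynomial.eval z u / MvPolynomial.eval z v := by
  classical
  obtain ⟨h, hh, rfl⟩ := List.mem_map.1 hτ
  have e : (2⁻¹ : ℂ) • (2 : ℂ) • h = h := by rw [smul_smul]; norm_num
  rcases List.mem_append.1 hh with hl | hs
  · refine Expn.finish _ (expn_long m
      (shortRoots.filter (fun γ => bil ((2 : ℂ) • h) γ = 3 * bil γ γ))
      (longRoots.filter (fun γ => bil ((2 : ℂ) • h) γ = bil γ γ)) h
      (fun γ hγ => short_ne (List.mem_filter.1 hγ).1)
      (fun γ hγ => long_ne (List.mem_filter.1 hγ).1) (long_ne hl)) (fun z => ?_) (fun z => ?_)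
    · simp only [aD1, kap, if_neg (long_not_twoShort hl), e, one_mul]
      try congr
    · convert long_sum m hl z
  · refine Expn.finish _ (expn_short m
      (shortRoots.filter (fun γ => bil ((2 : ℂ) • h) γ = bil γ γ))
      (longRoots.filter (fun γ => bil ((2 : ℂ) • h) γ = bil γ γ)) h
      (fun γ hγ => short_ne (List.mem_filter.1 hγ).1)
      (fun γ hγ => long_ne (List.mem_filter.1 hγ).1) (short_ne hs)) (fun z => ?_) (fun z => ?_)
    · simp only [aD1, kap, if_pos (short_twoShort hs), e, mul_assoc]
      try congr
    · convert short_sum m hs z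

end
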